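/- arXiv:cs/0505033 — 2 statements merged into one kernel-verified Lean document; each statement's English description precedes it below -/
import Mathlib

section
/- Let I be a finite type with decidable equality (the classes of stations), and define step : ((I → ℕ) × List I) → I → ((I → ℕ) × List I) by step (f, out) i = if (∑ j ≠ i, f j) < f i then (f, i :: out) else (Function.update f i (f i - 1), out). Then for every initial class-size function f₀ : I → ℕ and every list L : List I (the classes of the active stations in slot order), all elements of the list (List.foldl step (f₀, []) L).2 are equal. (In the second round following the last fault, all stations that pass the clique-avoidance test and send belong to one and the same class; this is the non-clique property of Theorem genP1.) -/
/-- Processing the slot of a station of class `i`: the station sends iff its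
class holds a strict majority among active stations, and otherwise leaves the
active state, decreasing its class size by one. -/
def step {I : Type*} [Fintype I] [DecidableEq I]
    (p : (I → ℕ) × List I) (i : I) : (I → ℕ) × List I :=
  if (∑ j ∈ Finset.univ.filter (fun j => j ≠ i), p.1 j) < p.1 i
    then (p.1, i :: p.2)
    else (Function.update p.1 i (p.1 i - 1), p.2)

/-- The class `a` holds a strict majority among the active stations. -/
def HasStrictMajority {I : Type*} [Fintype I] [DecidableEq I] (f : I → ℕ) (a : I) : Prop :=
  (∑ j ∈ Finset.univ.filter (fun j => j ≠ a), f j) < f a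

theorem HasStrictMajority.unique {I : Type*} [Fintype I] [DecidableEq I] {f : I → ℕ} {a b : I}
    (ha : HasStrictMajority f a) (hb : HasStrictMajority f b) : a = b := by
  by_contra hab
  have hba : f b ≤ ∑ j ∈ Finset.univ.filter (fun j => j ≠ a), f j :=
    Finset.single_le_sum_of_canonicallyOrdered (by simpa using Ne.symm hab)
  have hab' : f a ≤ ∑ j ∈ Finset.univ.filter (fun j => j ≠ b), f j :=
    Finset.single_le_sum_of_canonicallyOrdered (by simpa using hab)
  unfold HasStrictMajority at ha hb
  omega

theorem HasStrictMajority.mono {I : Type*} [Fintype I] [DecidableEq I] {f g : I → ℕ} {a : I}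
    (ha : HasStrictMajority f a) (hgf : g ≤ f) (hga : g a = f a) : HasStrictMajority g a := by
  unfold HasStrictMajority
  rw [hga]
  exact (Finset.sum_le_sum fun j _ => hgf j).trans_lt ha

theorem hasStrictMajority_of_mem_step {I : Type*} [Fintype I] [DecidableEq I]
    {p : (I → ℕ) × List I} (hp : ∀ a ∈ p.2, HasStrictMajority p.1 a) (i : I) :
    ∀ a ∈ (step p i).2, HasStrictMajority (step p i).1 a := by
  unfold step
  split_ifs with hi
  · exact List.forall_mem_cons.2 ⟨hi, hp⟩
  · intro a ha
    have hai : a ≠ i := fun h => hi (h ▸ hp a ha)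
    exact (hp a ha).mono (update_le_self_iff.2 (Nat.sub_le _ _))
      (Function.update_of_ne hai _ _)

theorem hasStrictMajority_of_mem_foldl_step {I : Type*} [Fintype I] [DecidableEq I]
    (L : List I) {p : (I → ℕ) × List I} (hp : ∀ a ∈ p.2, HasStrictMajority p.1 a) :
    ∀ a ∈ (List.foldl step p L).2, HasStrictMajority (List.foldl step p L).1 a := by
  induction L generalizing p with
  | nil => exact hp
  | cons i L ih => exact ih (hasStrictMajority_of_mem_step hp i)

/-- All stations that pass the clique-avoidance test and send belong to one
and the same class. -/
theorem stmt_8 {I : Type*} [Fintype I] [DecidableEq I]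
    (f₀ : I → ℕ) (L : List I) :
    ∀ a ∈ (List.foldl step (f₀, []) L).2, ∀ b ∈ (List.foldl step (f₀, []) L).2,
      a = b := by
  have h := hasStrictMajority_of_mem_foldl_step L (p := (f₀, [])) (by simp)
  exact fun a ha b hb => (h a ha).unique (h b hb)
end

section
/- Let I be a finite type with decidable equality (the classes of stations), and define step : ((I → ℕ) × List I) → I → ((I → ℕ) × List I) by step (f, out) i = if (∑ j ≠ i, f j) < f i then (f, i :: out) else (Function.update f i (f i - 1), out). Let f₀ : I → ℕ and i₀ : I with f₀ i₀ > ∑_{j ≠ i₀} f₀ j. Then for every list L : List I, every element of (List.foldl step (f₀, []) L).2 equals i₀, and the length of (List.foldl step (f₀, []) L).2 equals the number of occurrences of i₀ in L. (If one class initially holds a strict majority of the active stations, then exactly the stations of that class send in the subsequent round, and every station of the other classes is eliminated by the clique-avoidance mechanism at its turn.) -/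
/-- A slot of the majority class sends and leaves the class sizes unchanged. -/
theorem step_of_majority {I : Type*} [Fintype I] [DecidableEq I]
    {p : (I → ℕ) × List I} {i : I}
    (h : ∑ j ∈ Finset.univ.filter (fun j => j ≠ i), p.1 j < p.1 i) :
    step p i = (p.1, i :: p.2) :=
  if_pos h

/-- A slot of any class other than the majority class does not send. -/
theorem step_of_ne_majority {I : Type*} [Fintype I] [DecidableEq I]
    {p : (I → ℕ) × List I} {i k : I} (hk : k ≠ i)
    (h : ∑ j ∈ Finset.univ.filter (fun j => j ≠ i), p.1 j < p.1 i) :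
    step p k = (Function.update p.1 k (p.1 k - 1), p.2) := by
  have h₁ : p.1 k ≤ ∑ j ∈ Finset.univ.filter (fun j => j ≠ i), p.1 j :=
    Finset.single_le_sum_of_canonicallyOrdered (by simpa using hk)
  have h₂ : p.1 i ≤ ∑ j ∈ Finset.univ.filter (fun j => j ≠ k), p.1 j :=
    Finset.single_le_sum_of_canonicallyOrdered (by simpa using hk.symm)
  exact if_neg (by omega)

/-- A strict majority persists when another class loses a station. -/
theorem majority_update_pred {I : Type*} [Fintype I] [DecidableEq I]
    {f : I → ℕ} {i k : I} (hk : k ≠ i)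
    (h : ∑ j ∈ Finset.univ.filter (fun j => j ≠ i), f j < f i) :
    ∑ j ∈ Finset.univ.filter (fun j => j ≠ i), Function.update f k (f k - 1) j <
      Function.update f k (f k - 1) i := by
  rw [Function.update_of_ne hk.symm]
  refine (Finset.sum_le_sum fun j _ => ?_).trans_lt h
  exact update_le_self_iff.2 (Nat.sub_le _ _) j

/-- From a strict majority of class `i`, the slots in `L` add to the output one copy of `i`
for each occurrence of `i` in `L`, and nothing else. -/
theorem foldl_step_snd_of_majority {I : Type*} [Fintype I] [DecidableEq I]
    {i : I} (L : List I) (p : (I → ℕ) × List I)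
    (h : ∑ j ∈ Finset.univ.filter (fun j => j ≠ i), p.1 j < p.1 i) :
    (List.foldl step p L).2 = List.replicate (L.count i) i ++ p.2 := by
  induction L generalizing p with
  | nil => simp
  | cons k L ih =>
    rw [List.foldl_cons]
    rcases eq_or_ne k i with rfl | hk
    · rw [step_of_majority h, ih _ (by exact h), List.count_cons_self, List.replicate_succ',
        List.append_assoc, List.singleton_append]
    · rw [step_of_ne_majority hk h, ih _ (by exact majority_update_pred hk h),
        List.count_cons_of_ne hk]

/-- If one class initially holds a strict majority of the active stations,
then exactly the stations of that class send in the subsequent round, and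
every station of the other classes is eliminated at its turn. -/
theorem stmt_9 {I : Type*} [Fintype I] [DecidableEq I]
    (f₀ : I → ℕ) (i₀ : I)
    (hmaj : f₀ i₀ > ∑ j ∈ Finset.univ.filter (fun j => j ≠ i₀), f₀ j)
    (L : List I) :
    (∀ a ∈ (List.foldl step (f₀, []) L).2, a = i₀) ∧
    (List.foldl step (f₀, []) L).2.length = L.count i₀ := by
  rw [foldl_step_snd_of_majority L (f₀, []) hmaj, List.append_nil]
  exact ⟨fun _ => List.eq_of_mem_replicate, List.length_replicate⟩
end
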